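/- arXiv:2310.01672 — 2 statements merged into one kernel-verified Lean document; each statement's English description precedes it below -/
import Mathlib

section
/- Let (V̄, Ē) be a finite oriented graph with internal vertices V, boundary vertices ∂V, edge set Ē = E ∪ ∂E, and boundary temperatures T_j > 0 for j ∈ ∂V. Let μ^X be the product over V̄ of exponential distributions with mean 1. For every bounded measurable f : ℝ₊^V̄ × ℝ₊^V̄ → ℝ and every s ∈ ℝ₊^V̄ with s_j = T_j for all j ∈ ∂V, the key identity ∫ μ^X(dx) L^{X,T} f(x, s) = L^O f̃(s) holds, where f̃(s) := ∫ μ^X(dx) f(x, s) and L^O is the opinion-model generator with boundary conditions T_{∂V}. -/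
open MeasureTheory Finset

noncomputable section

/-- Update two coordinates of a configuration. -/
def upd2 {V : Type*} [DecidableEq V] {α : Type*} (x : V → α) (i j : V) (a b : α) : V → α :=
  Function.update (Function.update x i a) j b

/-- Generator of the joint KMP-temperature process `(X, T)`. -/
noncomputable def LXT {V : Type*} [Fintype V] [DecidableEq V]
    (Eint Ebd : Finset (V × V))
    (f : (V → ℝ) × (V → ℝ) → ℝ) (p : (V → ℝ) × (V → ℝ)) : ℝ :=
  (∑ e ∈ Eint, ∫ u in (0:ℝ)..1,
      (f (upd2 p.1 e.1 e.2 (u * (p.1 e.1 + p.1 e.2)) ((1 - u) * (p.1 e.1 + p.1 e.2)),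
          upd2 p.2 e.1 e.2
            ((p.1 e.1 * p.2 e.1 + p.1 e.2 * p.2 e.2) / (p.1 e.1 + p.1 e.2))
            ((p.1 e.1 * p.2 e.1 + p.1 e.2 * p.2 e.2) / (p.1 e.1 + p.1 e.2)))
        - f p))
  + ∑ e ∈ Ebd, ∫ b in Set.Ioi (0:ℝ), Real.exp (-b) * ∫ u in (0:ℝ)..1,
      (f (upd2 p.1 e.1 e.2 (u * (p.1 e.1 + p.1 e.2)) b,
          Function.update p.2 e.1
            ((p.1 e.1 * p.2 e.1 + p.1 e.2 * p.2 e.2) / (p.1 e.1 + p.1 e.2)))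
        - f p)

/-- Generator of the opinion model on the edge set `Ebar`, with stubborn individuals at the
boundary vertices `bd`. -/
noncomputable def LO {V : Type*} [Fintype V] [DecidableEq V]
    (Ebar : Finset (V × V)) (bd : Finset V)
    (f : (V → ℝ) → ℝ) (O : V → ℝ) : ℝ :=
  ∑ e ∈ Ebar, ∫ v in (0:ℝ)..1,
    (f (fun ℓ => if (ℓ = e.1 ∨ ℓ = e.2) ∧ ℓ ∉ bd
          then v * O e.1 + (1 - v) * O e.2 else O ℓ) - f O)

/-- The exponential distribution of mean `s`, as a measure on `ℝ`. -/
noncomputable def expMean (s : ℝ) : Measure ℝ :=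
  (volume.restrict (Set.Ioi 0)).withDensity fun x => ENNReal.ofReal (s⁻¹ * Real.exp (-x / s))

/-- The product over `V` of exponential distributions with mean `1`. -/
noncomputable def muX (V : Type*) [Fintype V] : Measure (V → ℝ) :=
  Measure.pi fun _ : V => expMean 1

/-- Uniform law on `(0,1]`. -/
def unifU : Measure ℝ := volume.restrict (Set.Ioc 0 1)

/-- Gamma(2) law. -/
def gam2 : Measure ℝ :=
  (volume.restrict (Set.Ioi 0)).withDensity fun x => ENNReal.ofReal (x * Real.exp (-x))

lemma expMean_one : expMean 1 =
    (volume.restrict (Set.Ioi 0)).withDensity fun x => ENNReal.ofReal (Real.exp (-x)) := by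
  simp [expMean]

instance unifU_prob : IsProbabilityMeasure unifU := ⟨by simp [unifU]⟩

instance gam2_sf : SFinite gam2 := by unfold gam2; infer_instance

instance expMean_prob : IsProbabilityMeasure (expMean 1) := ⟨by
  rw [expMean_one, withDensity_apply _ MeasurableSet.univ, Measure.restrict_univ,
    ← ofReal_integral_eq_lintegral_ofReal (integrableOn_exp_neg_Ioi 0)
      (Filter.Eventually.of_forall fun x => (Real.exp_pos _).le), integral_exp_neg_Ioi_zero]
  simp⟩

instance muX_prob (V : Type*) [Fintype V] : IsProbabilityMeasure (muX V) := by
  unfold muX; infer_instance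

lemma lintegral_scale {S : ℝ} (hS : 0 < S) (h : ℝ → ENNReal) (hh : Measurable h) :
    ∫⁻ x, h x = ENNReal.ofReal S * ∫⁻ v, h (v * S) := by
  have h1 := Real.smul_map_volume_mul_right hS.ne'
  conv_lhs => rw [← h1]
  rw [lintegral_smul_measure, lintegral_map hh (by fun_prop), abs_of_pos hS]
  rfl

lemma phi_pres : MeasurePreserving (fun p : ℝ × ℝ => (p.1 * p.2, (1 - p.1) * p.2))
    (unifU.prod gam2) ((expMean 1).prod (expMean 1)) := by
  refine ⟨by fun_prop, ?_⟩
  refine Measure.ext_of_lintegral _ fun g hg => ?_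
  rw [lintegral_map hg (by fun_prop)]
  let K : ℝ × ℝ → ENNReal := (Set.Ioi (0:ℝ) ×ˢ Set.Ioi (0:ℝ)).indicator
    fun p => ENNReal.ofReal (Real.exp (-(p.1 + p.2))) * g p
  have hK : Measurable K := by
    refine Measurable.indicator ?_ (measurableSet_Ioi.prod measurableSet_Ioi)
    fun_prop
  have hR : ∫⁻ p, g p ∂((expMean 1).prod (expMean 1)) = ∫⁻ x, ∫⁻ y, K (x, y) := by
    rw [expMean_one, prod_withDensity (by fun_prop) (by fun_prop), Measure.prod_restrict,
      lintegral_withDensity_eq_lintegral_mul _ (by fun_prop) hg,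
      ← lintegral_indicator (measurableSet_Ioi.prod measurableSet_Ioi),
      ← Measure.volume_eq_prod, Measure.volume_eq_prod, ← lintegral_prod _ hK.aemeasurable]
    congr 1
    funext p
    simp only [K, Set.indicator]
    split_ifs
    · simp only [Pi.mul_apply]
      rw [← ENNReal.ofReal_mul (Real.exp_pos _).le, ← Real.exp_add, neg_add]
    · rfl
  have hL : ∫⁻ p : ℝ × ℝ, g (p.1 * p.2, (1 - p.1) * p.2) ∂(unifU.prod gam2)
      = ∫⁻ S, ∫⁻ x, K (x, S - x) := by
    have hU : unifU = volume.restrict (Set.Ioo 0 1) :=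
      (Measure.restrict_congr_set Ioo_ae_eq_Ioc).symm
    rw [lintegral_prod_symm' _ (by fun_prop), gam2,
      lintegral_withDensity_eq_lintegral_mul _ (by fun_prop)
        (Measurable.lintegral_prod_left' (f := fun p : ℝ × ℝ => g (p.1 * p.2, (1 - p.1) * p.2)) (by fun_prop)),
      ← lintegral_indicator measurableSet_Ioi]
    congr 1
    funext S
    by_cases hS : 0 < S
    · rw [Set.indicator_of_mem (by exact hS), lintegral_scale hS _ (by fun_prop), Pi.mul_apply,
        ENNReal.ofReal_mul hS.le, mul_assoc, hU, ← lintegral_indicator measurableSet_Ioo,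
        ← lintegral_const_mul' _ _ ENNReal.ofReal_ne_top]
      congr 2
      funext v
      simp only [K, Set.indicator, Set.mem_prod, Set.mem_Ioi, Set.mem_Ioo]
      have e1 : 0 < v * S ↔ 0 < v := by simp [hS]
      have e2 : 0 < S - v * S ↔ v < 1 := by
        rw [show S - v * S = (1 - v) * S by ring]; simp [hS]
      simp only [e1, e2]
      split_ifs
      · rw [show S - v * S = (1 - v) * S by ring, show v * S + (1 - v) * S = S by ring]
      · simp
    · rw [Set.indicator_of_notMem (by exact hS)]
      symm
      rw [lintegral_eq_zero_iff (by fun_prop)]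
      refine Filter.Eventually.of_forall fun x => ?_
      refine Set.indicator_of_notMem ?_ _
      simp only [Set.mem_prod, Set.mem_Ioi]
      intro h; linarith [h.1, h.2]
  rw [hR, hL, lintegral_lintegral_swap (by
    refine Measurable.aemeasurable ?_; unfold Function.uncurry; fun_prop)]
  congr 1
  funext x
  exact lintegral_sub_right_eq_self (fun y => K (x, y)) x

lemma expMean_pos : ∀ᵐ x ∂(expMean 1), 0 < x := by
  rw [expMean_one]
  exact (withDensity_absolutelyContinuous _ _).ae_le (ae_restrict_mem measurableSet_Ioi)

lemma gam2_pos : ∀ᵐ x ∂gam2, 0 < x := by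
  rw [gam2]
  exact (withDensity_absolutelyContinuous _ _).ae_le (ae_restrict_mem measurableSet_Ioi)

lemma psi_pres : MeasurePreserving
    (fun p : (ℝ × ℝ) × ℝ => (p.1.1 / (p.1.1 + p.1.2),
      (p.2 * (p.1.1 + p.1.2), (1 - p.2) * (p.1.1 + p.1.2))))
    (((expMean 1).prod (expMean 1)).prod unifU)
    (unifU.prod ((expMean 1).prod (expMean 1))) := by
  have h1 := phi_pres.prod (MeasurePreserving.id unifU)
  have h2 := ((MeasurePreserving.id unifU).prod
    (phi_pres.comp (Measure.measurePreserving_swap (μ := gam2) (ν := unifU)))).comp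
    (measurePreserving_prodAssoc unifU gam2 unifU)
  refine ⟨by fun_prop, ?_⟩
  rw [← h1.map_eq, Measure.map_map (by fun_prop) h1.measurable, ← h2.map_eq]
  refine Measure.map_congr ?_
  have h3 : ∀ᵐ p ∂((unifU.prod gam2).prod unifU), 0 < p.1.2 :=
    Measure.quasiMeasurePreserving_fst.ae
      (Measure.quasiMeasurePreserving_snd.ae gam2_pos)
  filter_upwards [h3] with p hp
  obtain ⟨⟨v, S⟩, u⟩ := p
  simp only at hp
  have : v * S + (1 - v) * S = S := by ring
  simp [MeasurableEquiv.prodAssoc, this, hp.ne']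

lemma update_pres {V : Type*} [Fintype V] [DecidableEq V] (i : V) :
    MeasurePreserving (fun p : (V → ℝ) × ℝ => Function.update p.1 i p.2)
      ((muX V).prod (expMean 1)) (muX V) := by
  have hm : Measurable (fun p : (V → ℝ) × ℝ => Function.update p.1 i p.2) := by
    refine measurable_pi_iff.2 fun k => ?_
    by_cases hk : k = i
    · subst hk; simpa using measurable_snd
    · simp only [Function.update_of_ne hk]; fun_prop
  refine ⟨hm, ?_⟩
  symm
  refine Measure.pi_eq fun t ht => ?_
  rw [Measure.map_apply hm (MeasurableSet.univ_pi ht)]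
  have : (fun p : (V → ℝ) × ℝ => Function.update p.1 i p.2) ⁻¹' (Set.univ.pi t)
      = (Set.univ.pi (Function.update t i Set.univ)) ×ˢ (t i) := by
    ext ⟨x, a⟩
    simp only [Set.mem_preimage, Set.mem_pi, Set.mem_univ, forall_true_left, Set.mem_prod]
    constructor
    · intro h
      refine ⟨fun k => ?_, by simpa using h i⟩
      by_cases hk : k = i
      · subst hk; simp
      · simpa [hk] using h k
    · rintro ⟨h, h'⟩ k
      by_cases hk : k = i
      · subst hk; simpa using h'
      · simpa [hk] using h k
  rw [this, Measure.prod_prod, muX, Measure.pi_pi,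
    ← Finset.prod_erase_mul _ _ (Finset.mem_univ i),
    ← Finset.prod_erase_mul Finset.univ (fun k => (expMean 1) (t k)) (Finset.mem_univ i)]
  simp only [Function.update_self, measure_univ, mul_one]
  congr 1
  refine Finset.prod_congr rfl fun k hk => ?_
  rw [Function.update_of_ne (Finset.ne_of_mem_erase hk)]

lemma upd2_pres {V : Type*} [Fintype V] [DecidableEq V] (i j : V) :
    MeasurePreserving (fun p : (V → ℝ) × (ℝ × ℝ) => upd2 p.1 i j p.2.1 p.2.2)
      ((muX V).prod ((expMean 1).prod (expMean 1))) (muX V) := by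
  have h := (update_pres j).comp ((update_pres i).prod (MeasurePreserving.id (expMean 1)))
  exact h.comp (measurePreserving_prodAssoc _ _ _).symm

/-- Bounded measurable real functions. -/
def BM {X : Type*} [MeasurableSpace X] (h : X → ℝ) : Prop :=
  Measurable h ∧ ∃ C, ∀ x, |h x| ≤ C

lemma BM.comp {X Y : Type*} [MeasurableSpace X] [MeasurableSpace Y] {h : X → ℝ} (hh : BM h)
    {k : Y → X} (hk : Measurable k) : BM (fun y => h (k y)) :=
  ⟨hh.1.comp hk, hh.2.imp fun _ hC y => hC (k y)⟩

lemma BM.sub {X : Type*} [MeasurableSpace X] {h k : X → ℝ} (hh : BM h) (hk : BM k) :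
    BM (fun x => h x - k x) := by
  obtain ⟨C, hC⟩ := hh.2
  obtain ⟨D, hD⟩ := hk.2
  exact ⟨hh.1.sub hk.1, C + D, fun x => (abs_sub _ _).trans (add_le_add (hC x) (hD x))⟩

lemma BM.integrable {X : Type*} [MeasurableSpace X] {h : X → ℝ} (hh : BM h)
    (m : Measure X) [IsFiniteMeasure m] : Integrable h m := by
  obtain ⟨C, hC⟩ := hh.2
  exact Integrable.of_bound hh.1.aestronglyMeasurable C (Filter.Eventually.of_forall hC)

lemma BM.integral {X Y : Type*} [MeasurableSpace X] [MeasurableSpace Y] {h : X × Y → ℝ}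
    (hh : BM h) (m : Measure Y) [IsProbabilityMeasure m] : BM (fun x => ∫ y, h (x, y) ∂m) := by
  obtain ⟨C, hC⟩ := hh.2
  refine ⟨(hh.1.stronglyMeasurable.integral_prod_right').measurable, C, fun x => ?_⟩
  have := norm_integral_le_of_norm_le_const (μ := m) (f := fun y => h (x, y))
    (Filter.Eventually.of_forall fun y => hC (x, y))
  simpa using this

lemma meas_upd2 {V : Type*} [Fintype V] [DecidableEq V] {Y : Type*} [MeasurableSpace Y] (i j : V)
    {x : Y → V → ℝ} {a b : Y → ℝ} (hx : Measurable x) (ha : Measurable a) (hb : Measurable b) :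
    Measurable (fun y => upd2 (x y) i j (a y) (b y)) :=
  (upd2_pres i j).measurable.comp (hx.prodMk (ha.prodMk hb))

lemma meas_upd {V : Type*} [Fintype V] [DecidableEq V] {Y : Type*} [MeasurableSpace Y] (i : V)
    {x : Y → V → ℝ} {a : Y → ℝ} (hx : Measurable x) (ha : Measurable a) :
    Measurable (fun y => Function.update (x y) i (a y)) :=
  (update_pres i).measurable.comp (hx.prodMk ha)

lemma MP_integral {X Y : Type*} [MeasurableSpace X] [MeasurableSpace Y] {m : Measure X}
    {n : Measure Y} {k : X → Y} (hk : MeasurePreserving k m n) {h : Y → ℝ} (hh : BM h) :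
    ∫ x, h (k x) ∂m = ∫ y, h y ∂n := by
  rw [← hk.map_eq, integral_map hk.measurable.aemeasurable hh.1.aestronglyMeasurable]

lemma gen_id {V : Type*} [Fintype V] [DecidableEq V] {i j : V} (hij : i ≠ j)
    {g : (V → ℝ) × (V → ℝ) → ℝ} (hg : BM g) {τ : ℝ → V → ℝ} (hτ : Measurable τ) :
    ∫ x, ∫ u, g (upd2 x i j (u * (x i + x j)) ((1 - u) * (x i + x j)), τ (x i / (x i + x j)))
        ∂unifU ∂(muX V)
      = ∫ v, ∫ x, g (x, τ v) ∂(muX V) ∂unifU := by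
  have hk : BM (fun p : (V → ℝ) × ℝ => g (upd2 p.1 i j (p.2 * (p.1 i + p.1 j))
      ((1 - p.2) * (p.1 i + p.1 j)), τ (p.1 i / (p.1 i + p.1 j)))) :=
    hg.comp ((meas_upd2 i j (by fun_prop) (by fun_prop) (by fun_prop)).prodMk
      (hτ.comp (by fun_prop)))
  have hl : BM (fun p : (V → ℝ) × (ℝ × (ℝ × ℝ)) =>
      g (upd2 p.1 i j p.2.2.1 p.2.2.2, τ p.2.1)) :=
    hg.comp ((meas_upd2 i j (by fun_prop) (by fun_prop) (by fun_prop)).prodMk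
      (hτ.comp (by fun_prop)))
  rw [← integral_prod _ (hk.integrable _)]
  rw [← MP_integral ((upd2_pres i j).prod (MeasurePreserving.id unifU)) hk]
  have e1 := MP_integral (((MeasurePreserving.id (muX V)).prod psi_pres).comp
    (measurePreserving_prodAssoc (muX V) ((expMean 1).prod (expMean 1)) unifU)) hl
  have e2 : ∀ p : ((V → ℝ) × (ℝ × ℝ)) × ℝ, upd2 p.1.1 i j p.1.2.1 p.1.2.2 i = p.1.2.1 := by
    intro p; simp [upd2, hij]
  have e3 : ∀ p : ((V → ℝ) × (ℝ × ℝ)) × ℝ, upd2 p.1.1 i j p.1.2.1 p.1.2.2 j = p.1.2.2 := by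
    intro p; simp [upd2]
  have e4 : ∀ (x : V → ℝ) a b c d, upd2 (upd2 x i j a b) i j c d = upd2 x i j c d := by
    intro x a b c d
    funext k
    by_cases h1 : k = j
    · subst h1; simp [upd2]
    · by_cases h2 : k = i
      · subst h2; simp [upd2, h1]
      · simp [upd2, h1, h2]
  simp only [Prod.map_fst, Prod.map_snd, id, e2, e3, e4]
  refine Eq.trans ?_ (e1.trans ?_)
  · rfl
  · have hm : BM (fun p : (ℝ × (V → ℝ)) => g (p.2, τ p.1)) := hg.comp (by fun_prop)
    rw [← integral_prod (μ := unifU) (ν := muX V) _ (hm.integrable _)]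
    have hs := ((MeasurePreserving.id unifU).prod (upd2_pres i j)).comp
      ((measurePreserving_prodAssoc unifU (muX V) ((expMean 1).prod (expMean 1))).comp
      (((Measure.measurePreserving_swap (μ := muX V) (ν := unifU)).prod
        (MeasurePreserving.id ((expMean 1).prod (expMean 1)))).comp
        (measurePreserving_prodAssoc (muX V) unifU ((expMean 1).prod (expMean 1))).symm))
    exact MP_integral hs hm

lemma sum_pos_ae {V : Type*} [Fintype V] (i j : V) :
    ∀ᵐ x ∂(muX V), x i + x j ≠ 0 := by
  have h : ∀ k : V, ∀ᵐ x ∂(muX V), 0 < x k := fun k =>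
    (measurePreserving_eval (fun _ : V => expMean 1) k).quasiMeasurePreserving.ae expMean_pos
  filter_upwards [h i, h j] with x h1 h2
  positivity

lemma int_unif (h : ℝ → ℝ) : ∫ u in (0:ℝ)..1, h u = ∫ u, h u ∂unifU := by
  rw [intervalIntegral.integral_of_le zero_le_one]; rfl

lemma int_exp (h : ℝ → ℝ) :
    ∫ b in Set.Ioi (0:ℝ), Real.exp (-b) * h b = ∫ b, h b ∂(expMean 1) := by
  rw [expMean_one, integral_withDensity_eq_integral_toReal_smul (by fun_prop)
    (Filter.Eventually.of_forall fun x => ENNReal.ofReal_lt_top)]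
  simp [ENNReal.toReal_ofReal (Real.exp_pos _).le]

lemma avg_eq {a b c d : ℝ} (h : a + b ≠ 0) :
    (a * c + b * d) / (a + b) = a / (a + b) * c + (1 - a / (a + b)) * d := by
  field_simp
  ring

lemma int_sub_const {X : Type*} [MeasurableSpace X] {m : Measure X} [IsProbabilityMeasure m]
    {h : X → ℝ} (hh : BM h) (c : ℝ) : ∫ x, (h x - c) ∂m = ∫ x, h x ∂m - c := by
  rw [integral_sub (hh.integrable _) (integrable_const _)]
  simp

section terms
variable {V : Type*} [Fintype V] [DecidableEq V]

/-- Interior edge term. -/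
lemma int_term {i j : V} (hij : i ≠ j) {f : (V → ℝ) × (V → ℝ) → ℝ} (hf : BM f) (s : V → ℝ) :
    Integrable (fun x => ∫ u in (0:ℝ)..1,
      (f (upd2 x i j (u * (x i + x j)) ((1 - u) * (x i + x j)),
          upd2 s i j ((x i * s i + x j * s j) / (x i + x j))
            ((x i * s i + x j * s j) / (x i + x j))) - f (x, s))) (muX V) ∧
    ∫ x, (∫ u in (0:ℝ)..1,
      (f (upd2 x i j (u * (x i + x j)) ((1 - u) * (x i + x j)),
          upd2 s i j ((x i * s i + x j * s j) / (x i + x j))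
            ((x i * s i + x j * s j) / (x i + x j))) - f (x, s))) ∂(muX V)
    = ∫ v in (0:ℝ)..1, ((∫ x, f (x, upd2 s i j (v * s i + (1 - v) * s j)
        (v * s i + (1 - v) * s j)) ∂(muX V)) - ∫ x, f (x, s) ∂(muX V)) := by
  simp only [int_unif]
  have h1 : BM (fun p : (V → ℝ) × ℝ =>
      f (upd2 p.1 i j (p.2 * (p.1 i + p.1 j)) ((1 - p.2) * (p.1 i + p.1 j)),
          upd2 s i j ((p.1 i * s i + p.1 j * s j) / (p.1 i + p.1 j))
            ((p.1 i * s i + p.1 j * s j) / (p.1 i + p.1 j)))) :=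
    hf.comp ((meas_upd2 i j (by fun_prop) (by fun_prop) (by fun_prop)).prodMk
      (meas_upd2 i j (by fun_prop) (by fun_prop) (by fun_prop)))
  have h2 : BM (fun x : V → ℝ => f (x, s)) := hf.comp (by fun_prop)
  have hτ : Measurable (fun v : ℝ => upd2 s i j (v * s i + (1 - v) * s j)
        (v * s i + (1 - v) * s j)) := meas_upd2 i j (by fun_prop) (by fun_prop) (by fun_prop)
  have h3 : BM (fun p : ℝ × (V → ℝ) => f (p.2, upd2 s i j (p.1 * s i + (1 - p.1) * s j)
        (p.1 * s i + (1 - p.1) * s j))) :=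
    hf.comp (measurable_snd.prodMk (hτ.comp measurable_fst))
  have h4 := h1.sub (h2.comp measurable_fst)
  refine ⟨(h4.integral unifU).integrable _, ?_⟩
  rw [int_sub_const (h3.integral _), ← gen_id hij hf hτ,
    ← integral_sub _ (h2.integrable _)]
  · refine integral_congr_ae ?_
    filter_upwards [sum_pos_ae i j] with x hx
    have h10 := h1.comp (k := fun u : ℝ => (x, u)) (by fun_prop)
    simp only at h10
    rw [int_sub_const h10, avg_eq hx]
  · exact ((hf.comp (k := fun p : (V → ℝ) × ℝ =>
      (upd2 p.1 i j (p.2 * (p.1 i + p.1 j)) ((1 - p.2) * (p.1 i + p.1 j)), _))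
      ((meas_upd2 i j (by fun_prop) (by fun_prop) (by fun_prop)).prodMk
        (hτ.comp (g := _) (f := fun p : (V → ℝ) × ℝ => p.1 i / (p.1 i + p.1 j))
          (by fun_prop)))).integral unifU).integrable _

/-- Boundary edge term. -/
lemma bd_term {i j : V} (hij : i ≠ j) {f : (V → ℝ) × (V → ℝ) → ℝ} (hf : BM f) (s : V → ℝ) :
    Integrable (fun x => ∫ b in Set.Ioi (0:ℝ), Real.exp (-b) * ∫ u in (0:ℝ)..1,
      (f (upd2 x i j (u * (x i + x j)) b,
          Function.update s i ((x i * s i + x j * s j) / (x i + x j))) - f (x, s))) (muX V) ∧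
    ∫ x, (∫ b in Set.Ioi (0:ℝ), Real.exp (-b) * ∫ u in (0:ℝ)..1,
      (f (upd2 x i j (u * (x i + x j)) b,
          Function.update s i ((x i * s i + x j * s j) / (x i + x j))) - f (x, s))) ∂(muX V)
    = ∫ v in (0:ℝ)..1, ((∫ x, f (x, Function.update s i (v * s i + (1 - v) * s j)) ∂(muX V))
        - ∫ x, f (x, s) ∂(muX V)) := by
  simp only [int_unif, int_exp]
  have h1 : BM (fun p : ((V → ℝ) × ℝ) × ℝ =>
      f (upd2 p.1.1 i j (p.2 * (p.1.1 i + p.1.1 j)) p.1.2,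
          Function.update s i ((p.1.1 i * s i + p.1.1 j * s j) / (p.1.1 i + p.1.1 j)))) :=
    hf.comp ((meas_upd2 i j (by fun_prop) (by fun_prop) (by fun_prop)).prodMk
      (meas_upd i (by fun_prop) (by fun_prop)))
  have h2 : BM (fun x : V → ℝ => f (x, s)) := hf.comp (by fun_prop)
  have hτ : Measurable (fun v : ℝ => Function.update s i (v * s i + (1 - v) * s j)) :=
    meas_upd i (by fun_prop) (by fun_prop)
  have h3 : BM (fun p : ℝ × (V → ℝ) => f (p.2, Function.update s i
        (p.1 * s i + (1 - p.1) * s j))) :=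
    hf.comp (measurable_snd.prodMk (hτ.comp measurable_fst))
  have h4 := h1.sub (h2.comp (measurable_fst.comp measurable_fst))
  refine ⟨((h4.integral unifU).integral (expMean 1)).integrable _, ?_⟩
  have h5 : BM (fun p : ((V → ℝ) × (V → ℝ)) × ℝ => f (Function.update p.1.1 j p.2, p.1.2)) :=
    hf.comp ((meas_upd j (by fun_prop) (by fun_prop)).prodMk (by fun_prop))
  have h6 := h5.integral (expMean 1)
  have h7 : ∀ t : V → ℝ, ∫ x, f (x, t) ∂(muX V)
      = ∫ x, ∫ b, f (Function.update x j b, t) ∂(expMean 1) ∂(muX V) := by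
    intro t
    have h8 : BM (fun x : V → ℝ => f (x, t)) := hf.comp (by fun_prop)
    rw [← MP_integral (update_pres j) h8,
      integral_prod _ ((h8.comp (update_pres j).measurable).integrable _)]
  rw [int_sub_const (h3.integral _)]
  simp only [fun v => h7 (Function.update s i (v * s i + (1 - v) * s j))]
  have h9 := gen_id hij h6 hτ
  simp only at h9
  rw [← h9, ← integral_sub _ (h2.integrable _)]
  · refine integral_congr_ae ?_
    filter_upwards [sum_pos_ae i j] with x hx
    have h10 : BM (fun p : ℝ × ℝ => f (upd2 x i j (p.2 * (x i + x j)) p.1,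
          Function.update s i ((x i * s i + x j * s j) / (x i + x j)))) :=
      h1.comp (k := fun p : ℝ × ℝ => ((x, p.1), p.2)) (by fun_prop)
    have h11 : ∀ b, ∫ u, (f (upd2 x i j (u * (x i + x j)) b,
          Function.update s i ((x i * s i + x j * s j) / (x i + x j))) - f (x, s)) ∂unifU
        = ∫ u, f (upd2 x i j (u * (x i + x j)) b,
          Function.update s i ((x i * s i + x j * s j) / (x i + x j))) ∂unifU - f (x, s) :=
      fun b => int_sub_const (h10.comp (k := fun u : ℝ => (b, u)) (by fun_prop)) _
    simp only [h11]
    rw [int_sub_const (h10.integral unifU), integral_integral_swap (h10.integrable _), avg_eq hx]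
    simp only [upd2, Function.update_idem]
  · exact ((h6.comp (k := fun p : (V → ℝ) × ℝ =>
      (upd2 p.1 i j (p.2 * (p.1 i + p.1 j)) ((1 - p.2) * (p.1 i + p.1 j)), _))
      ((meas_upd2 i j (by fun_prop) (by fun_prop) (by fun_prop)).prodMk
        (hτ.comp (g := _) (f := fun p : (V → ℝ) × ℝ => p.1 i / (p.1 i + p.1 j))
          (by fun_prop)))).integral unifU).integrable _

end terms

/-- the key identity `∫ μ^X(dx) L^{X,T} f(x, s) = L^O f̃(s)`, where
`f̃(s) = ∫ μ^X(dx) f(x,s)`. -/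
theorem key_identity
    {V : Type*} [Fintype V] [DecidableEq V]
    (bd : Finset V) (Eint Ebd : Finset (V × V)) (T : V → ℝ)
    (hE : ∀ e ∈ Eint, e.1 ∉ bd ∧ e.2 ∉ bd ∧ e.1 ≠ e.2)
    (hEb : ∀ e ∈ Ebd, e.1 ∉ bd ∧ e.2 ∈ bd)
    (hT : ∀ j ∈ bd, 0 < T j)
    (f : (V → ℝ) × (V → ℝ) → ℝ) (hfm : Measurable f) (hfb : ∃ C, ∀ p, |f p| ≤ C)
    (s : V → ℝ) (hs : ∀ i, 0 ≤ s i) (hsbd : ∀ j ∈ bd, s j = T j) :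
    ∫ x, LXT Eint Ebd f (x, s) ∂(muX V)
      = LO (Eint ∪ Ebd) bd (fun t => ∫ x, f (x, t) ∂(muX V)) s := by
  have hf : BM f := ⟨hfm, hfb⟩
  have hd : Disjoint Eint Ebd := by
    rw [Finset.disjoint_left]
    intro e h1 h2
    exact (hE e h1).2.1 (hEb e h2).2
  have hne : ∀ e ∈ Ebd, e.1 ≠ e.2 := fun e he h => (hEb e he).1 (h ▸ (hEb e he).2)
  unfold LXT LO
  rw [integral_add (integrable_finsetSum _ fun e he => (int_term (hE e he).2.2 hf s).1)
      (integrable_finsetSum _ fun e he => (bd_term (hne e he) hf s).1),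
    integral_finsetSum _ (fun e he => (int_term (hE e he).2.2 hf s).1),
    integral_finsetSum _ (fun e he => (bd_term (hne e he) hf s).1),
    Finset.sum_union hd]
  congr 1
  · refine Finset.sum_congr rfl fun e he => ?_
    rw [(int_term (hE e he).2.2 hf s).2]
    have : ∀ v : ℝ, (fun ℓ => if (ℓ = e.1 ∨ ℓ = e.2) ∧ ℓ ∉ bd
          then v * s e.1 + (1 - v) * s e.2 else s ℓ)
        = upd2 s e.1 e.2 (v * s e.1 + (1 - v) * s e.2) (v * s e.1 + (1 - v) * s e.2) := by
      intro v
      obtain ⟨ha, hb, hc⟩ := hE e he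
      funext k
      by_cases h1 : k = e.2
      · simp [upd2, h1, hb]
      · by_cases h2 : k = e.1
        · simp [upd2, h2, ha, hc]
        · simp [upd2, h1, h2]
    simp only [this]
  · refine Finset.sum_congr rfl fun e he => ?_
    rw [(bd_term (hne e he) hf s).2]
    have : ∀ v : ℝ, (fun ℓ => if (ℓ = e.1 ∨ ℓ = e.2) ∧ ℓ ∉ bd
          then v * s e.1 + (1 - v) * s e.2 else s ℓ)
        = Function.update s e.1 (v * s e.1 + (1 - v) * s e.2) := by
      intro v
      obtain ⟨ha, hb⟩ := hEb e he
      have hc := hne e he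
      funext k
      by_cases h2 : k = e.1
      · simp [h2, ha]
      · by_cases h1 : k = e.2
        · simp [h1, hb, hc.symm]
        · simp [h1, h2]
    simp only [this]

end
end

section
/- Let (V̄, Ē) be a finite oriented graph with internal vertices V, boundary vertices ∂V, edge set Ē = E ∪ ∂E, and boundary temperatures T_j > 0 for j ∈ ∂V. Let ν be a probability measure on ℝ₊^V̄ with bounded support contained in vectors with strictly positive coordinates satisfying s_j = T_j for all j ∈ ∂V, invariant for the opinion model, i.e. ∫ L^O f dν = 0 for every bounded measurable f. Define the probability measure μ^K on ℕ₀^V̄ by μ^K({k}) = ∫ ν(ds) ∏_{i∈V̄} (s_i/(s_i+1))^{k_i} · 1/(s_i+1) (a mixture of products of geometric distributions). Then μ^K is invariant for the boundary driven discrete KMP generator: Σ_{k∈ℕ₀^V̄} μ^K({k}) L^K g(k) = 0 for every bounded g : ℕ₀^V̄ → ℝ. -/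
open MeasureTheory Finset

noncomputable section

/-- Generator of the boundary driven discrete KMP process with boundary conditions `T`. -/
noncomputable def LK {V : Type*} [Fintype V] [DecidableEq V]
    (Eint Ebd : Finset (V × V)) (T : V → ℝ)
    (g : (V → ℕ) → ℝ) (k : V → ℕ) : ℝ :=
  (∑ e ∈ Eint, (1 / (k e.1 + k e.2 + 1 : ℝ)) *
      ∑ h ∈ Finset.range (k e.1 + k e.2 + 1),
        (g (upd2 k e.1 e.2 h (k e.1 + k e.2 - h)) - g k))
  + ∑ e ∈ Ebd, (1 / (k e.1 + k e.2 + 1 : ℝ)) *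
      ∑ h ∈ Finset.range (k e.1 + k e.2 + 1),
        ∑' b : ℕ, (T e.2 / (T e.2 + 1)) ^ b * (1 / (T e.2 + 1)) *
          (g (upd2 k e.1 e.2 h b) - g k)

/-- Geometric weights, with the parameter replaced by its absolute value. -/
def geo (x : ℝ) (n : ℕ) : ℝ := (|x| / (|x| + 1)) ^ n * (1 / (|x| + 1))

lemma geo_nonneg (x : ℝ) (n : ℕ) : 0 ≤ geo x n := by
  unfold geo; positivity

lemma geo_hasSum (x : ℝ) : HasSum (geo x) 1 := by
  have hx : 0 < |x| + 1 := by positivity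
  have h := (hasSum_geometric_of_lt_one (r := |x| / (|x| + 1)) (by positivity)
    (by rw [div_lt_one hx]; linarith)).mul_right (1 / (|x| + 1))
  have e : (1 - |x| / (|x| + 1))⁻¹ * (1 / (|x| + 1)) = 1 := by
    have : 1 - |x| / (|x| + 1) = 1 / (|x| + 1) := by field_simp; ring
    rw [this]; field_simp
  rw [e] at h
  exact h

lemma geo_measurable (n : ℕ) : Measurable (fun x => geo x n) := by
  unfold geo
  have : Measurable (fun x : ℝ => |x|) := continuous_abs.measurable
  fun_prop

/-- Geometric weights in `ℝ≥0∞`. -/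
def geoE (x : ℝ) (n : ℕ) : ENNReal := ENNReal.ofReal (geo x n)

lemma geoE_tsum (x : ℝ) : ∑' n, geoE x n = 1 := by
  unfold geoE
  rw [← ENNReal.ofReal_tsum_of_nonneg (geo_nonneg x) (geo_hasSum x).summable,
    (geo_hasSum x).tsum_eq, ENNReal.ofReal_one]

lemma geoE_measurable (n : ℕ) : Measurable (fun x => geoE x n) :=
  (geo_measurable n).ennreal_ofReal

section Weights
variable {V : Type*} [Fintype V]

/-- Product geometric weights. -/
def wt (s : V → ℝ) (k : V → ℕ) : ℝ := ∏ i, geo (s i) (k i)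

lemma wt_nonneg (s : V → ℝ) (k : V → ℕ) : 0 ≤ wt s k :=
  Finset.prod_nonneg fun _ _ => geo_nonneg _ _

lemma wt_measurable (k : V → ℕ) : Measurable (fun s : V → ℝ => wt s k) := by
  unfold wt
  exact Finset.measurable_fun_prod _ fun i _ => (geo_measurable (k i)).comp (measurable_pi_apply i)

lemma wt_ofReal (s : V → ℝ) (k : V → ℕ) :
    ENNReal.ofReal (wt s k) = ∏ i, geoE (s i) (k i) :=
  ENNReal.ofReal_prod_of_nonneg fun _ _ => geo_nonneg _ _

lemma wt_tsum (s : V → ℝ) : ∑' k, ENNReal.ofReal (wt s k) = 1 := by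
  let p : ℝ → PMF ℕ := fun x => ⟨geoE x, by
    have := ENNReal.summable.hasSum (f := geoE x)
    rwa [geoE_tsum] at this⟩
  let m := Measure.pi (fun i : V => (p (s i)).toMeasure)
  have h := Measure.tsum_indicator_apply_singleton m Set.univ MeasurableSet.univ
  rw [measure_univ] at h
  rw [← h]
  refine tsum_congr fun k => ?_
  rw [Set.indicator_univ, Measure.pi_singleton, wt_ofReal]
  refine Finset.prod_congr rfl fun i _ => ?_
  rw [PMF.toMeasure_apply_singleton _ _ (measurableSet_singleton _)]
  rfl

lemma wt_hasSum (s : V → ℝ) : HasSum (wt s) 1 := by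
  have h := ENNReal.hasSum_toReal (f := fun k => ENNReal.ofReal (wt s k)) (by rw [wt_tsum]; simp)
  rw [← ENNReal.tsum_toReal_eq (by simp), wt_tsum] at h
  simpa [ENNReal.toReal_ofReal (wt_nonneg s _)] using h

/-- Expectation under the product geometric distribution. -/
def FR (ψ : (V → ℕ) → ℝ) (s : V → ℝ) : ℝ := ∑' k, wt s k * ψ k

lemma FR_summable {ψ : (V → ℕ) → ℝ} {M : ℝ} (h0 : ∀ k, 0 ≤ ψ k) (hM : ∀ k, ψ k ≤ M)
    (s : V → ℝ) : Summable (fun k => wt s k * ψ k) :=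
  Summable.of_nonneg_of_le (fun k => mul_nonneg (wt_nonneg s k) (h0 k))
    (fun k => mul_le_mul_of_nonneg_left (hM k) (wt_nonneg s k))
    ((wt_hasSum s).summable.mul_right M)

lemma FR_nonneg {ψ : (V → ℕ) → ℝ} (h0 : ∀ k, 0 ≤ ψ k) (s : V → ℝ) : 0 ≤ FR ψ s :=
  tsum_nonneg fun k => mul_nonneg (wt_nonneg s k) (h0 k)

lemma FR_le {ψ : (V → ℕ) → ℝ} {M : ℝ} (h0 : ∀ k, 0 ≤ ψ k) (hM : ∀ k, ψ k ≤ M)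
    (s : V → ℝ) : FR ψ s ≤ M := by
  have h := (FR_summable h0 hM s).tsum_le_tsum
    (fun k => mul_le_mul_of_nonneg_left (hM k) (wt_nonneg s k))
    ((wt_hasSum s).summable.mul_right M)
  rwa [((wt_hasSum s).mul_right M).tsum_eq, one_mul] at h

lemma FR_abs_le {ψ : (V → ℕ) → ℝ} {M : ℝ} (h0 : ∀ k, 0 ≤ ψ k) (hM : ∀ k, ψ k ≤ M)
    (s : V → ℝ) : |FR ψ s| ≤ M := by
  rw [abs_of_nonneg (FR_nonneg h0 s)]; exact FR_le h0 hM s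

lemma FR_ofReal {ψ : (V → ℕ) → ℝ} {M : ℝ} (h0 : ∀ k, 0 ≤ ψ k) (hM : ∀ k, ψ k ≤ M)
    (s : V → ℝ) : ENNReal.ofReal (FR ψ s) =
      ∑' k, ENNReal.ofReal (wt s k) * ENNReal.ofReal (ψ k) := by
  unfold FR
  rw [ENNReal.ofReal_tsum_of_nonneg (fun k => mul_nonneg (wt_nonneg s k) (h0 k))
    (FR_summable h0 hM s)]
  exact tsum_congr fun k => ENNReal.ofReal_mul (wt_nonneg s k)

lemma FR_measurable {ψ : (V → ℕ) → ℝ} {M : ℝ} (h0 : ∀ k, 0 ≤ ψ k) (hM : ∀ k, ψ k ≤ M) :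
    Measurable (FR ψ) := by
  have h : FR ψ = fun s => (∑' k, ENNReal.ofReal (wt s k) * ENNReal.ofReal (ψ k)).toReal := by
    funext s
    rw [← FR_ofReal h0 hM, ENNReal.toReal_ofReal (FR_nonneg h0 s)]
  rw [h]
  exact (Measurable.tsum fun k =>
    (wt_measurable k).ennreal_ofReal.mul_const _).ennreal_toReal

lemma FR_hasSum_integral (ν : Measure (V → ℝ)) [IsProbabilityMeasure ν]
    {ψ : (V → ℕ) → ℝ} {M : ℝ} (h0 : ∀ k, 0 ≤ ψ k) (hM : ∀ k, ψ k ≤ M) :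
    HasSum (fun k => (∫ s, wt s k ∂ν) * ψ k) (∫ s, FR ψ s ∂ν) := by
  have h := hasSum_integral_of_dominated_convergence (μ := ν)
    (F := fun k s => wt s k * ψ k) (f := FR ψ) (fun k s => wt s k * M)
    (fun k => ((wt_measurable k).mul_const _).aestronglyMeasurable)
    (fun k => Filter.Eventually.of_forall fun s => by
      rw [Real.norm_of_nonneg (mul_nonneg (wt_nonneg s k) (h0 k))]
      exact mul_le_mul_of_nonneg_left (hM k) (wt_nonneg s k))
    (Filter.Eventually.of_forall fun s => (wt_hasSum s).summable.mul_right M)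
    (by
      have : (fun s : V → ℝ => ∑' k, wt s k * M) = fun _ => 1 * M := by
        funext s; exact ((wt_hasSum s).mul_right M).tsum_eq
      rw [this]; exact integrable_const _)
    (Filter.Eventually.of_forall fun s => (FR_summable h0 hM s).hasSum)
  simpa [integral_mul_const] using h

end Weights

/-- The mixing integral. -/
lemma geo_mix {x y : ℝ} (hx : 0 < x) (hy : 0 < y) (n h : ℕ) (hh : h ≤ n) :
    ∫ v in (0:ℝ)..1, geo (v * x + (1 - v) * y) h * geo (v * x + (1 - v) * y) (n - h)
      = (1 / (n + 1 : ℝ)) * ∑ a ∈ range (n + 1), geo x a * geo y (n - a) := by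
  have hpos : ∀ v ∈ Set.uIcc (0:ℝ) 1, 0 < v * x + (1 - v) * y := by
    intro v hv
    rw [Set.uIcc_of_le zero_le_one] at hv
    rcases hv.1.eq_or_lt with h | h
    · subst h; simpa using hy
    · have : 0 ≤ (1 - v) * y := mul_nonneg (by linarith [hv.2]) hy.le
      have := mul_pos h hx
      linarith
  have hn : (n + 1 : ℝ) ≠ 0 := by positivity
  have hD : ∀ u : ℝ, 0 < u → ∀ m ≤ n, geo u m * geo u (n - m)
      = (u / (u + 1)) ^ n * (1 / (u + 1)) ^ 2 := by
    intro u hu m hm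
    unfold geo
    rw [abs_of_pos hu]
    have : (u / (u + 1)) ^ n = (u / (u + 1)) ^ m * (u / (u + 1)) ^ (n - m) := by
      rw [← pow_add, Nat.add_sub_cancel' hm]
    rw [this]; ring
  have e1 : ∫ v in (0:ℝ)..1, geo (v * x + (1 - v) * y) h * geo (v * x + (1 - v) * y) (n - h)
      = ∫ v in (0:ℝ)..1, ((v * x + (1 - v) * y) / ((v * x + (1 - v) * y) + 1)) ^ n
          * (1 / ((v * x + (1 - v) * y) + 1)) ^ 2 :=
    intervalIntegral.integral_congr fun v hv => hD _ (hpos v hv) h hh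
  rw [e1]
  by_cases hxy : x = y
  · subst hxy
    have : ∀ v : ℝ, v * x + (1 - v) * x = x := fun v => by ring
    simp only [this]
    rw [Finset.sum_congr rfl fun a ha => hD x hx a (by simp at ha; omega)]
    simp
    field_simp
  · have hxy' : x - y ≠ 0 := sub_ne_zero.2 hxy
    rw [intervalIntegral.integral_eq_sub_of_hasDerivAt
      (f := fun v => ((v * x + (1 - v) * y) / ((v * x + (1 - v) * y) + 1)) ^ (n + 1)
        / ((n + 1) * (x - y)))]
    · have g2 := geom_sum₂_mul (x / (x + 1)) (y / (y + 1)) (n + 1)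
      have e2 : ∑ a ∈ range (n + 1), geo x a * geo y (n - a)
          = (∑ i ∈ range (n + 1), (x / (x + 1)) ^ i * (y / (y + 1)) ^ (n + 1 - 1 - i))
            * (1 / ((x + 1) * (y + 1))) := by
        rw [Finset.sum_mul]
        refine Finset.sum_congr rfl fun a _ => ?_
        unfold geo
        rw [abs_of_pos hx, abs_of_pos hy, Nat.add_sub_cancel]
        field_simp
      have e3 : x / (x + 1) - y / (y + 1) = (x - y) / ((x + 1) * (y + 1)) := by
        field_simp; ring
      rw [e3] at g2
      rw [e2]
      simp only [one_mul, zero_mul, sub_self, sub_zero, add_zero, zero_add]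
      rw [← sub_div, ← g2]
      field_simp
    · intro v hv
      have hp := hpos v hv
      have d1 : HasDerivAt (fun v : ℝ => v * x + (1 - v) * y) (x - y) v := by
        have := ((hasDerivAt_id v).mul_const x).add
          (((hasDerivAt_id v).const_sub 1).mul_const y)
        convert! this using 1
        ring
      have d2 := ((d1.div (d1.add_const 1) (by positivity)).pow (n + 1)).div_const
        ((n + 1) * (x - y))
      convert! d2 using 1
      simp only [Nat.add_sub_cancel, Pi.div_apply]
      push_cast
      field_simp
      ring
    · apply ContinuousOn.intervalIntegrable
      have : ContinuousOn (fun v : ℝ => v * x + (1 - v) * y) (Set.uIcc 0 1) := by fun_prop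
      refine ContinuousOn.mul (ContinuousOn.pow (ContinuousOn.div this (this.add continuousOn_const) ?_) _) (ContinuousOn.pow (ContinuousOn.div continuousOn_const (this.add continuousOn_const) ?_) _)
      all_goals
        intro v hv
        have := hpos v hv
        exact (by linarith : 0 < v * x + (1 - v) * y + 1).ne'

lemma tsum_antidiag (φ : ℕ → ℕ → ENNReal) :
    ∑' a, ∑' b, φ a b = ∑' n, ∑ h ∈ range (n + 1), φ h (n - h) := by
  rw [← ENNReal.tsum_prod, ← (Finset.HasAntidiagonal.sigmaAntidiagonalEquivProd (A := ℕ)).tsum_eq,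
    ENNReal.tsum_sigma']
  refine tsum_congr fun n => ?_
  rw [← Finset.Nat.sum_antidiagonal_eq_sum_range_succ, tsum_fintype]
  exact Finset.sum_coe_sort (Finset.HasAntidiagonal.antidiagonal n) (fun p : ℕ × ℕ => φ p.1 p.2)

lemma mix_measurable (x y : ℝ) : Measurable (fun v : ℝ => v * x + (1 - v) * y) := by
  fun_prop

lemma geo_le_one (x : ℝ) (n : ℕ) : geo x n ≤ 1 := by
  have := (geo_hasSum x).summable.le_tsum n (fun m _ => geo_nonneg x m)
  rwa [(geo_hasSum x).tsum_eq] at this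

lemma geo_mixE {x y : ℝ} (hx : 0 < x) (hy : 0 < y) (n h : ℕ) (hh : h ≤ n) :
    ∫⁻ v in Set.Ioc (0:ℝ) 1, geoE (v * x + (1 - v) * y) h * geoE (v * x + (1 - v) * y) (n - h)
      = ENNReal.ofReal (1 / (n + 1 : ℝ)) * ∑ a ∈ range (n + 1), geoE x a * geoE y (n - a) := by
  have h1 := geo_mix hx hy n h hh
  rw [intervalIntegral.integral_of_le zero_le_one] at h1
  have h2 := congrArg ENNReal.ofReal h1
  rw [ofReal_integral_eq_lintegral_ofReal, ENNReal.ofReal_mul (by positivity),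
    ENNReal.ofReal_sum_of_nonneg (fun a _ => mul_nonneg (geo_nonneg _ _) (geo_nonneg _ _))] at h2
  · simp only [ENNReal.ofReal_mul (geo_nonneg _ _)] at h2
    exact h2
  · refine Integrable.of_bound (C := 1) ?_ ?_
    · exact (((geo_measurable h).comp (mix_measurable x y)).mul
        ((geo_measurable (n - h)).comp (mix_measurable x y))).aestronglyMeasurable
    · refine Filter.Eventually.of_forall fun v => ?_
      rw [Real.norm_of_nonneg (mul_nonneg (geo_nonneg _ _) (geo_nonneg _ _))]
      exact mul_le_one₀ (geo_le_one _ _) (geo_nonneg _ _) (geo_le_one _ _)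
  · exact Filter.Eventually.of_forall fun v => mul_nonneg (geo_nonneg _ _) (geo_nonneg _ _)

lemma two_site {x y : ℝ} (hx : 0 < x) (hy : 0 < y) (φ : ℕ → ℕ → ENNReal) :
    ∑' a, ∑' b, geoE x a * geoE y b *
        (ENNReal.ofReal (1 / (a + b + 1 : ℝ)) * ∑ h ∈ range (a + b + 1), φ h (a + b - h))
      = ∫⁻ v in Set.Ioc (0:ℝ) 1, ∑' a, ∑' b,
          geoE (v * x + (1 - v) * y) a * geoE (v * x + (1 - v) * y) b * φ a b := by
  have hm : ∀ a, Measurable (fun v : ℝ => geoE (v * x + (1 - v) * y) a) := fun a =>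
    (geoE_measurable a).comp (mix_measurable x y)
  simp_rw [tsum_antidiag]
  rw [lintegral_tsum]
  · refine tsum_congr fun n => ?_
    have hm2 : ∀ h, Measurable (fun v : ℝ => geoE (v * x + (1 - v) * y) h *
        geoE (v * x + (1 - v) * y) (n - h)) := fun h => (hm h).mul (hm (n - h))
    rw [lintegral_finsetSum' _ (fun h _ => ((hm2 h).mul_const (φ h (n - h))).aemeasurable)]
    have e : ∀ h ∈ range (n + 1),
        ∫⁻ v in Set.Ioc (0:ℝ) 1, geoE (v * x + (1 - v) * y) h *
          geoE (v * x + (1 - v) * y) (n - h) * φ h (n - h)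
        = ENNReal.ofReal (1 / (n + 1 : ℝ)) *
          (∑ a ∈ range (n + 1), geoE x a * geoE y (n - a)) * φ h (n - h) := by
      intro h hh
      rw [lintegral_mul_const _ (hm2 h),
        geo_mixE hx hy n h (by simp at hh; omega)]
    rw [Finset.sum_congr rfl e, ← Finset.mul_sum]
    have e' : ∀ a ∈ range (n + 1),
        geoE x a * geoE y (n - a) * (ENNReal.ofReal (1 / ((a:ℝ) + ((n - a : ℕ) : ℝ) + 1)) *
          ∑ h ∈ range (a + (n - a) + 1), φ h (a + (n - a) - h))
        = geoE x a * geoE y (n - a) * (ENNReal.ofReal (1 / ((n:ℝ) + 1)) *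
          ∑ h ∈ range (n + 1), φ h (n - h)) := by
      intro a ha
      have ha' : a + (n - a) = n := by simp at ha; omega
      rw [← Nat.cast_add, ha']
    rw [Finset.sum_congr rfl e', ← Finset.sum_mul]
    ring
  · intro n
    exact (Finset.measurable_fun_sum _ fun h _ => ((hm h).mul (hm _)).mul_const _).aemeasurable

lemma two_site_bd {x y : ℝ} (hx : 0 < x) (hy : 0 < y) (φ : ℕ → ℕ → ENNReal) :
    ∑' a, ∑' b, geoE x a * geoE y b *
        (ENNReal.ofReal (1 / (a + b + 1 : ℝ)) * ∑ h ∈ range (a + b + 1),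
          ∑' c, geoE y c * φ h c)
      = ∫⁻ v in Set.Ioc (0:ℝ) 1, ∑' a, ∑' b,
          geoE (v * x + (1 - v) * y) a * geoE y b * φ a b := by
  rw [two_site hx hy (fun h _ => ∑' c, geoE y c * φ h c)]
  refine lintegral_congr fun v => tsum_congr fun a => ?_
  simp_rw [mul_assoc]
  rw [ENNReal.tsum_mul_left, ENNReal.tsum_mul_left, ENNReal.tsum_mul_right, geoE_tsum, one_mul]

set_option linter.unusedSectionVars false

section Split
variable {V : Type*} [Fintype V] [DecidableEq V]

lemma upd2_fst {α : Type*} (k : V → α) {i j : V} (hij : i ≠ j) (a b : α) :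
    upd2 k i j a b i = a := by
  simp [upd2, hij]

lemma upd2_snd {α : Type*} (k : V → α) (i j : V) (a b : α) :
    upd2 k i j a b j = b := by
  simp [upd2]

lemma upd2_other {α : Type*} (k : V → α) {i j l : V} (hi : l ≠ i) (hj : l ≠ j) (a b : α) :
    upd2 k i j a b l = k l := by
  simp [upd2, hi, hj]

lemma upd2_upd2 {α : Type*} (k : V → α) {i j : V} (hij : i ≠ j) (a b c d : α) :
    upd2 (upd2 k i j a b) i j c d = upd2 k i j c d := by
  funext l
  by_cases hj : l = j
  · subst hj; simp [upd2_snd]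
  by_cases hi : l = i
  · subst hi; simp [upd2_fst _ hij]
  simp [upd2_other _ hi hj]

/-- Splitting off two coordinates. -/
def splitEquiv {i j : V} (hij : i ≠ j) :
    {k : V → ℕ // k i = 0 ∧ k j = 0} × ℕ × ℕ ≃ (V → ℕ) where
  toFun p := upd2 p.1.1 i j p.2.1 p.2.2
  invFun k := (⟨upd2 k i j 0 0, upd2_fst _ hij _ _, upd2_snd _ _ _ _ _⟩, k i, k j)
  left_inv := by
    rintro ⟨⟨k, hk⟩, a, b⟩
    simp only [upd2_fst _ hij, upd2_snd, upd2_upd2 _ hij]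
    congr 2
    funext l
    by_cases hj : l = j
    · subst hj; simp [upd2_snd, hk.2]
    by_cases hi : l = i
    · subst hi; simp [upd2_fst _ hij, hk.1]
    simp [upd2_other _ hi hj]
  right_inv := by
    intro k
    simp only [upd2_upd2 _ hij]
    funext l
    by_cases hj : l = j
    · subst hj; simp [upd2_snd]
    by_cases hi : l = i
    · subst hi; simp [upd2_fst _ hij]
    simp [upd2_other _ hi hj]

lemma tsum_split {i j : V} (hij : i ≠ j) (Φ : (V → ℕ) → ENNReal) :
    ∑' k, Φ k = ∑' k : {k : V → ℕ // k i = 0 ∧ k j = 0}, ∑' a, ∑' b,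
      Φ (upd2 k.1 i j a b) := by
  rw [← (splitEquiv hij).tsum_eq, ENNReal.tsum_prod']
  refine tsum_congr fun k => ?_
  rw [ENNReal.tsum_prod']
  rfl

lemma wt_split {i j : V} (hij : i ≠ j) (s : V → ℝ) (k : V → ℕ) (a b : ℕ) :
    ENNReal.ofReal (wt s (upd2 k i j a b)) =
      (∏ l ∈ (univ.erase i).erase j, geoE (s l) (k l)) * (geoE (s i) a * geoE (s j) b) := by
  rw [wt_ofReal, ← Finset.mul_prod_erase univ _ (Finset.mem_univ i),
    ← Finset.mul_prod_erase (univ.erase i) _ (Finset.mem_erase.2 ⟨hij.symm, Finset.mem_univ j⟩),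
    upd2_fst _ hij, upd2_snd]
  rw [Finset.prod_congr (g := fun l => geoE (s l) (k l)) rfl]
  · ring
  · intro l hl
    simp only [Finset.mem_erase] at hl
    rw [upd2_other _ hl.2.1 hl.1]

/-- The opinion update. -/
def HO (bd : Finset V) (e : V × V) (O : V → ℝ) (v : ℝ) : V → ℝ :=
  fun ℓ => if (ℓ = e.1 ∨ ℓ = e.2) ∧ ℓ ∉ bd then v * O e.1 + (1 - v) * O e.2 else O ℓ

/-- Real gain term on internal edges. -/
def Aint (e : V × V) (ψ : (V → ℕ) → ℝ) (k : V → ℕ) : ℝ :=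
  (1 / (k e.1 + k e.2 + 1 : ℝ)) *
      ∑ h ∈ Finset.range (k e.1 + k e.2 + 1), ψ (upd2 k e.1 e.2 h (k e.1 + k e.2 - h))

/-- Real gain term on boundary edges. -/
def Abd (T : V → ℝ) (e : V × V) (ψ : (V → ℕ) → ℝ) (k : V → ℕ) : ℝ :=
  (1 / (k e.1 + k e.2 + 1 : ℝ)) *
      ∑ h ∈ Finset.range (k e.1 + k e.2 + 1), ∑' b : ℕ, geo (T e.2) b * ψ (upd2 k e.1 e.2 h b)

lemma wt_HO_split {bd : Finset V} {e : V × V} (hij : e.1 ≠ e.2) (s : V → ℝ) (v : ℝ)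
    (k : V → ℕ) (a b : ℕ) :
    ENNReal.ofReal (wt (HO bd e s v) (upd2 k e.1 e.2 a b)) =
      (∏ l ∈ (univ.erase e.1).erase e.2, geoE (s l) (k l)) *
        (geoE (HO bd e s v e.1) a * geoE (HO bd e s v e.2) b) := by
  rw [wt_split hij]
  congr 1
  refine Finset.prod_congr rfl fun l hl => ?_
  simp only [Finset.mem_erase] at hl
  simp [HO, hl.1, hl.2.1]

lemma HO_measurable (bd : Finset V) (e : V × V) :
    Measurable (fun p : (V → ℝ) × ℝ => HO bd e p.1 p.2) := by
  refine measurable_pi_lambda _ fun l => ?_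
  unfold HO
  by_cases h : (l = e.1 ∨ l = e.2) ∧ l ∉ bd
  · simp only [if_pos h]
    fun_prop
  · simp only [if_neg h]
    fun_prop

lemma HO_measurable_right (bd : Finset V) (e : V × V) (O : V → ℝ) :
    Measurable (fun v : ℝ => HO bd e O v) :=
  (HO_measurable bd e).comp (measurable_const.prodMk measurable_id)

lemma ofReal_integral_FR (bd : Finset V) (e : V × V) (s : V → ℝ)
    {ψ : (V → ℕ) → ℝ} {M : ℝ} (h0 : ∀ k, 0 ≤ ψ k) (hM : ∀ k, ψ k ≤ M) :
    ENNReal.ofReal (∫ v in (0:ℝ)..1, FR ψ (HO bd e s v)) =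
      ∫⁻ v in Set.Ioc (0:ℝ) 1, ∑' k, ENNReal.ofReal (wt (HO bd e s v) k) *
        ENNReal.ofReal (ψ k) := by
  rw [intervalIntegral.integral_of_le zero_le_one, ofReal_integral_eq_lintegral_ofReal]
  · exact lintegral_congr fun v => FR_ofReal h0 hM _
  · refine Integrable.of_bound (C := M)
      ((FR_measurable h0 hM).comp (HO_measurable_right bd e s)).aestronglyMeasurable ?_
    exact Filter.Eventually.of_forall fun v => FR_abs_le h0 hM _
  · exact Filter.Eventually.of_forall fun v => FR_nonneg h0 _

lemma Aint_nonneg (e : V × V) {ψ : (V → ℕ) → ℝ} (h0 : ∀ k, 0 ≤ ψ k) (k : V → ℕ) :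
    0 ≤ Aint e ψ k :=
  mul_nonneg (by positivity) (Finset.sum_nonneg fun _ _ => h0 _)

lemma avg_le {n m : ℕ} {f : ℕ → ℝ} {M : ℝ} (hf : ∀ h, f h ≤ M) :
    (1 / (n + m + 1 : ℝ)) * ∑ h ∈ Finset.range (n + m + 1), f h ≤ M := by
  have h1 : ∑ h ∈ Finset.range (n + m + 1), f h ≤ (n + m + 1 : ℝ) * M := by
    refine (Finset.sum_le_sum fun h _ => hf h).trans ?_
    simp
  rw [one_div, inv_mul_le_iff₀ (by positivity)]
  exact h1

lemma Aint_le (e : V × V) {ψ : (V → ℕ) → ℝ} {M : ℝ} (hM : ∀ k, ψ k ≤ M) (k : V → ℕ) :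
    Aint e ψ k ≤ M :=
  avg_le fun _ => hM _

lemma geo_summable (x : ℝ) {f : ℕ → ℝ} {M : ℝ} (h0 : ∀ k, 0 ≤ f k) (hM : ∀ k, f k ≤ M) :
    Summable (fun b => geo x b * f b) :=
  Summable.of_nonneg_of_le (fun k => mul_nonneg (geo_nonneg x k) (h0 k))
    (fun k => mul_le_mul_of_nonneg_left (hM k) (geo_nonneg x k))
    ((geo_hasSum x).summable.mul_right M)

lemma geo_tsum_le (x : ℝ) {f : ℕ → ℝ} {M : ℝ} (h0 : ∀ k, 0 ≤ f k) (hM : ∀ k, f k ≤ M) :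
    ∑' b, geo x b * f b ≤ M := by
  have h := (geo_summable x h0 hM).tsum_le_tsum
    (fun k => mul_le_mul_of_nonneg_left (hM k) (geo_nonneg x k))
    ((geo_hasSum x).summable.mul_right M)
  rwa [((geo_hasSum x).mul_right M).tsum_eq, one_mul] at h

lemma Abd_nonneg (T : V → ℝ) (e : V × V) {ψ : (V → ℕ) → ℝ} (h0 : ∀ k, 0 ≤ ψ k) (k : V → ℕ) :
    0 ≤ Abd T e ψ k :=
  mul_nonneg (by positivity) (Finset.sum_nonneg fun _ _ => tsum_nonneg fun _ =>
    mul_nonneg (geo_nonneg _ _) (h0 _))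

lemma Abd_le (T : V → ℝ) (e : V × V) {ψ : (V → ℕ) → ℝ} {M : ℝ} (h0 : ∀ k, 0 ≤ ψ k)
    (hM : ∀ k, ψ k ≤ M) (k : V → ℕ) : Abd T e ψ k ≤ M :=
  avg_le fun _ => geo_tsum_le _ (fun _ => h0 _) (fun _ => hM _)

/-- Intertwining for internal edges. -/
lemma FR_Aint {bd : Finset V} {e : V × V} (he : e.1 ∉ bd ∧ e.2 ∉ bd ∧ e.1 ≠ e.2)
    {s : V → ℝ} (hs : ∀ i, 0 < s i) {ψ : (V → ℕ) → ℝ} {M : ℝ}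
    (h0 : ∀ k, 0 ≤ ψ k) (hM : ∀ k, ψ k ≤ M) :
    FR (Aint e ψ) s = ∫ v in (0:ℝ)..1, FR ψ (HO bd e s v) := by
  have hij := he.2.2
  rw [← ENNReal.ofReal_eq_ofReal_iff (FR_nonneg (Aint_nonneg e h0) s)
    (intervalIntegral.integral_nonneg zero_le_one fun v _ => FR_nonneg h0 _),
    ofReal_integral_FR bd e s h0 hM, FR_ofReal (Aint_nonneg e h0) (Aint_le e hM), tsum_split hij]
  simp_rw [tsum_split hij (fun k => ENNReal.ofReal (wt (HO bd e s _) k) * ENNReal.ofReal (ψ k)),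
    wt_HO_split hij, wt_split hij]
  have hH1 : ∀ v, HO bd e s v e.1 = v * s e.1 + (1 - v) * s e.2 := fun v => by
    simp [HO, he.1]
  have hH2 : ∀ v, HO bd e s v e.2 = v * s e.1 + (1 - v) * s e.2 := fun v => by
    simp [HO, he.2.1]
  simp_rw [hH1, hH2]
  have hm : ∀ a, Measurable (fun v : ℝ => geoE (v * s e.1 + (1 - v) * s e.2) a) := fun a =>
    (geoE_measurable a).comp (mix_measurable _ _)
  rw [lintegral_tsum]
  · refine tsum_congr fun k => ?_
    have h2 := two_site (hs e.1) (hs e.2)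
      (fun a b => ENNReal.ofReal (ψ (upd2 k.1 e.1 e.2 a b)))
    simp_rw [mul_assoc, ENNReal.tsum_mul_left]
    simp_rw [mul_assoc, ENNReal.tsum_mul_left] at h2
    rw [lintegral_const_mul, ← h2]
    · congr 1
      refine tsum_congr fun a => ?_
      congr 1
      refine tsum_congr fun b => ?_
      congr 1
      unfold Aint
      simp only [upd2_fst _ hij, upd2_snd, upd2_upd2 _ hij]
      rw [ENNReal.ofReal_mul (by positivity), ENNReal.ofReal_sum_of_nonneg (fun _ _ => h0 _)]
    · exact Measurable.tsum fun a => (hm a).mul (Measurable.tsum fun b => (hm b).mul_const _)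
  · intro k
    exact (Measurable.tsum fun a => Measurable.tsum fun b =>
      (((hm a).mul (hm b)).const_mul _).mul_const _).aemeasurable

/-- Intertwining for boundary edges. -/
lemma FR_Abd {bd : Finset V} {e : V × V} (he : e.1 ∉ bd ∧ e.2 ∈ bd) {T : V → ℝ}
    {s : V → ℝ} (hs : ∀ i, 0 < s i) (hsT : s e.2 = T e.2) {ψ : (V → ℕ) → ℝ} {M : ℝ}
    (h0 : ∀ k, 0 ≤ ψ k) (hM : ∀ k, ψ k ≤ M) :
    FR (Abd T e ψ) s = ∫ v in (0:ℝ)..1, FR ψ (HO bd e s v) := by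
  have hij : e.1 ≠ e.2 := fun h => he.1 (h ▸ he.2)
  rw [← ENNReal.ofReal_eq_ofReal_iff (FR_nonneg (Abd_nonneg T e h0) s)
    (intervalIntegral.integral_nonneg zero_le_one fun v _ => FR_nonneg h0 _),
    ofReal_integral_FR bd e s h0 hM, FR_ofReal (Abd_nonneg T e h0) (Abd_le T e h0 hM),
    tsum_split hij]
  simp_rw [tsum_split hij (fun k => ENNReal.ofReal (wt (HO bd e s _) k) * ENNReal.ofReal (ψ k)),
    wt_HO_split hij, wt_split hij]
  have hH1 : ∀ v, HO bd e s v e.1 = v * s e.1 + (1 - v) * s e.2 := fun v => by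
    simp [HO, he.1]
  have hH2 : ∀ v, HO bd e s v e.2 = s e.2 := fun v => by
    simp [HO, he.2]
  simp_rw [hH1, hH2]
  have hm : ∀ a, Measurable (fun v : ℝ => geoE (v * s e.1 + (1 - v) * s e.2) a) := fun a =>
    (geoE_measurable a).comp (mix_measurable _ _)
  rw [lintegral_tsum]
  · refine tsum_congr fun k => ?_
    have h2 := two_site_bd (hs e.1) (hs e.2)
      (fun a b => ENNReal.ofReal (ψ (upd2 k.1 e.1 e.2 a b)))
    simp_rw [mul_assoc, ENNReal.tsum_mul_left]
    simp_rw [mul_assoc, ENNReal.tsum_mul_left] at h2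
    rw [lintegral_const_mul, ← h2]
    · congr 1
      refine tsum_congr fun a => ?_
      congr 1
      refine tsum_congr fun b => ?_
      congr 1
      unfold Abd
      simp only [upd2_fst _ hij, upd2_snd, upd2_upd2 _ hij]
      rw [ENNReal.ofReal_mul (by positivity), ENNReal.ofReal_sum_of_nonneg
        (fun _ _ => tsum_nonneg fun _ => mul_nonneg (geo_nonneg _ _) (h0 _))]
      congr 1
      refine Finset.sum_congr rfl fun h _ => ?_
      rw [ENNReal.ofReal_tsum_of_nonneg (fun _ => mul_nonneg (geo_nonneg _ _) (h0 _))
        (geo_summable _ (fun _ => h0 _) (fun _ => hM _)), hsT]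
      exact tsum_congr fun c => ENNReal.ofReal_mul (geo_nonneg _ _)
    · exact Measurable.tsum fun a => (hm a).mul_const _
  · intro k
    exact (Measurable.tsum fun a => Measurable.tsum fun b =>
      (((hm a).mul_const _).const_mul _).mul_const _).aemeasurable

lemma LO_eq (E : Finset (V × V)) (bd : Finset V) {ψ : (V → ℕ) → ℝ} {M : ℝ}
    (h0 : ∀ k, 0 ≤ ψ k) (hM : ∀ k, ψ k ≤ M) (O : V → ℝ) :
    LO E bd (FR ψ) O = ∑ e ∈ E, ((∫ v in (0:ℝ)..1, FR ψ (HO bd e O v)) - FR ψ O) := by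
  unfold LO
  refine Finset.sum_congr rfl fun e _ => ?_
  have hi : IntervalIntegrable (fun v => FR ψ (HO bd e O v)) volume 0 1 := by
    rw [intervalIntegrable_iff]
    refine Measure.integrableOn_of_bounded (M := M) (by simp)
      ((FR_measurable h0 hM).comp (HO_measurable_right bd e O)).aestronglyMeasurable ?_
    exact Filter.Eventually.of_forall fun v => FR_abs_le h0 hM _
  have := intervalIntegral.integral_sub hi
    (intervalIntegrable_const (μ := volume) (a := 0) (b := 1) (c := FR ψ O))
  refine Eq.trans this ?_
  simp

lemma HOint_integrable (ν : Measure (V → ℝ)) [IsProbabilityMeasure ν] (bd : Finset V)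
    (e : V × V) {ψ : (V → ℕ) → ℝ} {M : ℝ} (h0 : ∀ k, 0 ≤ ψ k) (hM : ∀ k, ψ k ≤ M) :
    Integrable (fun O => ∫ v in (0:ℝ)..1, FR ψ (HO bd e O v)) ν := by
  refine Integrable.of_bound (C := M) ?_ ?_
  · simp_rw [intervalIntegral.integral_of_le zero_le_one]
    refine (StronglyMeasurable.integral_prod_right ?_).aestronglyMeasurable
    exact ((FR_measurable h0 hM).comp (HO_measurable bd e)).stronglyMeasurable
  · refine Filter.Eventually.of_forall fun O => ?_
    have := intervalIntegral.norm_integral_le_of_norm_le_const (a := 0) (b := 1)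
      (f := fun v => FR ψ (HO bd e O v)) (C := M) (fun v _ => FR_abs_le h0 hM _)
    simpa using this

lemma FR_integrable (ν : Measure (V → ℝ)) [IsProbabilityMeasure ν]
    {ψ : (V → ℕ) → ℝ} {M : ℝ} (h0 : ∀ k, 0 ≤ ψ k) (hM : ∀ k, ψ k ≤ M) :
    Integrable (FR ψ) ν :=
  Integrable.of_bound (C := M) (FR_measurable h0 hM).aestronglyMeasurable
    (Filter.Eventually.of_forall fun _ => FR_abs_le h0 hM _)

lemma LO_integral (ν : Measure (V → ℝ)) [IsProbabilityMeasure ν] (E : Finset (V × V))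
    (bd : Finset V) {ψ : (V → ℕ) → ℝ} {M : ℝ} (h0 : ∀ k, 0 ≤ ψ k) (hM : ∀ k, ψ k ≤ M) :
    ∫ O, LO E bd (FR ψ) O ∂ν = ∑ e ∈ E,
      ((∫ O, (∫ v in (0:ℝ)..1, FR ψ (HO bd e O v)) ∂ν) - ∫ O, FR ψ O ∂ν) := by
  simp_rw [LO_eq E bd h0 hM]
  have hi : ∀ e ∈ E, Integrable
      (fun O => (∫ v in (0:ℝ)..1, FR ψ (HO bd e O v)) - FR ψ O) ν := fun e _ =>
    (HOint_integrable ν bd e h0 hM).sub (FR_integrable ν h0 hM)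
  rw [integral_finsetSum _ hi]
  exact Finset.sum_congr rfl fun e _ =>
    integral_sub (HOint_integrable ν bd e h0 hM) (FR_integrable ν h0 hM)

lemma avg_sub (n m : ℕ) (f : ℕ → ℝ) (c : ℝ) :
    (1 / (n + m + 1 : ℝ)) * ∑ h ∈ Finset.range (n + m + 1), (f h - c)
      = (1 / (n + m + 1 : ℝ)) * (∑ h ∈ Finset.range (n + m + 1), f h) - c := by
  rw [Finset.sum_sub_distrib, mul_sub]
  congr 1
  have : (n + m + 1 : ℝ) ≠ 0 := by positivity
  simp
  field_simp

lemma LK_eq (Eint Ebd : Finset (V × V)) {T : V → ℝ} (hT : ∀ e ∈ Ebd, 0 < T e.2)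
    (g : (V → ℕ) → ℝ) {C M : ℝ} (h0 : ∀ k, 0 ≤ g k + C) (hM : ∀ k, g k + C ≤ M) (k : V → ℕ) :
    LK Eint Ebd T g k = ∑ e ∈ Eint, (Aint e (fun k => g k + C) k - (g k + C))
      + ∑ e ∈ Ebd, (Abd T e (fun k => g k + C) k - (g k + C)) := by
  unfold LK
  congr 1
  · refine Finset.sum_congr rfl fun e _ => ?_
    unfold Aint
    rw [← avg_sub]
    congr 1
    exact Finset.sum_congr rfl fun h _ => by ring
  · refine Finset.sum_congr rfl fun e he => ?_
    unfold Abd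
    rw [← avg_sub]
    congr 1
    refine Finset.sum_congr rfl fun h _ => ?_
    have h1 := (geo_summable (T e.2) (f := fun b => g (upd2 k e.1 e.2 h b) + C)
      (fun _ => h0 _) (fun _ => hM _)).hasSum.sub ((geo_hasSum (T e.2)).mul_right (g k + C))
    rw [one_mul] at h1
    rw [← h1.tsum_eq]
    refine tsum_congr fun b => ?_
    unfold geo
    rw [abs_of_pos (hT e he)]
    ring

end Split

/-- if `ν` is invariant for the opinion model, then the mixture of products of
geometric distributions with parameter measure `ν` is invariant for the boundary driven
discrete KMP process. -/
theorem geometric_mixture_invariant_discrete_KMP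
    {V : Type*} [Fintype V] [DecidableEq V]
    (bd : Finset V) (Eint Ebd : Finset (V × V)) (T : V → ℝ)
    (hE : ∀ e ∈ Eint, e.1 ∉ bd ∧ e.2 ∉ bd ∧ e.1 ≠ e.2)
    (hEb : ∀ e ∈ Ebd, e.1 ∉ bd ∧ e.2 ∈ bd)
    (hT : ∀ j ∈ bd, 0 < T j)
    (ν : Measure (V → ℝ)) [IsProbabilityMeasure ν] (R : ℝ)
    (hsupp : ∀ᵐ s ∂ν, ∀ i, 0 < s i ∧ s i ≤ R)
    (hsbd : ∀ᵐ s ∂ν, ∀ j ∈ bd, s j = T j)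
    (hinv : ∀ f : (V → ℝ) → ℝ, Measurable f → (∃ C, ∀ x, |f x| ≤ C) →
        ∫ O, LO (Eint ∪ Ebd) bd f O ∂ν = 0)
    (g : (V → ℕ) → ℝ) (hg : ∃ C, ∀ x, |g x| ≤ C) :
    ∑' k : V → ℕ,
        (∫ s, ∏ i, ((s i / (s i + 1)) ^ (k i) * (1 / (s i + 1))) ∂ν)
          * LK Eint Ebd T g k = 0 := by
  obtain ⟨C, hC⟩ := hg
  have h0 : ∀ k, 0 ≤ g k + C := fun k => by linarith [(abs_le.1 (hC k)).1]
  have hM : ∀ k, g k + C ≤ 2 * C := fun k => by linarith [(abs_le.1 (hC k)).2]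
  have hpos : ∀ᵐ s ∂ν, ∀ i, 0 < s i := hsupp.mono fun s hs i => (hs i).1
  have hμ : ∀ k : V → ℕ, ∫ s, ∏ i, ((s i / (s i + 1)) ^ (k i) * (1 / (s i + 1))) ∂ν
      = ∫ s, wt s k ∂ν := by
    intro k
    refine integral_congr_ae (hpos.mono fun s hs => ?_)
    refine Finset.prod_congr rfl fun i _ => ?_
    unfold geo
    rw [abs_of_pos (hs i)]
  simp_rw [hμ, LK_eq Eint Ebd (fun e he => hT _ (hEb e he).2) g h0 hM]
  set ψ : (V → ℕ) → ℝ := fun k => g k + C with hψ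
  have h0' : ∀ k, 0 ≤ ψ k := h0
  have hM' : ∀ k, ψ k ≤ 2 * C := hM
  have hdisj : Disjoint Eint Ebd := by
    rw [Finset.disjoint_left]
    intro e h1 h2
    exact (hE e h1).2.1 (hEb e h2).2
  have hI := hinv (FR ψ) (FR_measurable h0' hM') ⟨2 * C, fun x => FR_abs_le h0' hM' x⟩
  rw [LO_integral ν (Eint ∪ Ebd) bd h0' hM'] at hI
  rw [Finset.sum_union hdisj] at hI
  have hsum0 := FR_hasSum_integral ν h0' hM'
  have hs1 : ∀ e ∈ Eint, HasSum (fun k => (∫ s, wt s k ∂ν) * (Aint e ψ k - (g k + C)))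
      ((∫ O, (∫ v in (0:ℝ)..1, FR ψ (HO bd e O v)) ∂ν) - ∫ O, FR ψ O ∂ν) := by
    intro e he
    have h1 := FR_hasSum_integral ν (Aint_nonneg e h0') (Aint_le e hM')
    rw [integral_congr_ae (hpos.mono fun s hs => FR_Aint (hE e he) hs h0' hM')] at h1
    simpa only [mul_sub] using h1.sub hsum0
  have hs2 : ∀ e ∈ Ebd, HasSum (fun k => (∫ s, wt s k ∂ν) * (Abd T e ψ k - (g k + C)))
      ((∫ O, (∫ v in (0:ℝ)..1, FR ψ (HO bd e O v)) ∂ν) - ∫ O, FR ψ O ∂ν) := by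
    intro e he
    have h1 := FR_hasSum_integral ν (Abd_nonneg T e h0') (Abd_le T e h0' hM')
    rw [integral_congr_ae ((hpos.and hsbd).mono fun s hs =>
      FR_Abd (hEb e he) hs.1 (hs.2 _ (hEb e he).2) h0' hM')] at h1
    simpa only [mul_sub] using h1.sub hsum0
  have hfin := (hasSum_sum hs1).add (hasSum_sum hs2)
  rw [hI] at hfin
  simp_rw [mul_add, Finset.mul_sum]
  exact hfin.tsum_eq

end
end
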